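/- arXiv:2410.12701 — 11 statements merged into one kernel-verified Lean document; each statement's English description precedes it below -/
import Mathlib

section
/- There exists a unique k-algebra homomorphism ν_I : 𝒟 → 𝒟 satisfying ν_I(D_j) = D_j − g⁻¹·x_j for all 1 ≤ j ≤ L and ν_I(D_s) = D_s for all L < s ≤ N. -/
/-!
The diffusion algebra of type `A_I` on `N` generators over a field `k`,
with `I = {0, …, L-1}` and `S = {L, …, N-1}` (a 0-indexed version of
`I = {1,…,L}`, `S = {L+1,…,N}`).  It is the quotient of the free associative
unital `k`-algebra on generators `D_0, …, D_{N-1}` by the two-sided ideal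
generated by the defining relations below.
-/

noncomputable section

namespace DiffusionAI

open FreeAlgebra

variable (k : Type*) [Field k] (N L : ℕ) (g : k) (x : Fin N → k) (gs : Fin N → k)

/-- The defining relations of the type `A_I` diffusion algebra:
`g·D_i·D_j = g·D_j·D_i + x_j·D_i − x_i·D_j` for `i < j` in `I`,
`g_s·D_s·D_i = g_s·D_i·D_s + x_i·D_s` for `i ∈ I`, `s ∈ S`, and
`D_s·D_l = D_l·D_s` for `s < l` in `S`. -/
def rel : FreeAlgebra k (Fin N) → FreeAlgebra k (Fin N) → Prop := fun a b =>
  (∃ i j : Fin N, (i : ℕ) < (j : ℕ) ∧ (j : ℕ) < L ∧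
      a = g • (ι k i * ι k j) ∧
      b = g • (ι k j * ι k i) + x j • ι k i - x i • ι k j) ∨
  (∃ i s : Fin N, (i : ℕ) < L ∧ L ≤ (s : ℕ) ∧
      a = gs s • (ι k s * ι k i) ∧
      b = gs s • (ι k i * ι k s) + x i • ι k s) ∨
  (∃ s l : Fin N, L ≤ (s : ℕ) ∧ (s : ℕ) < (l : ℕ) ∧
      a = ι k s * ι k l ∧ b = ι k l * ι k s)

/-- The diffusion algebra `𝒟` of type `A_I`. -/
abbrev Diff := RingQuot (rel k N L g x gs)

/-- The images of the generators `D_i` in `𝒟`. -/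
def D (i : Fin N) : Diff k N L g x gs :=
  RingQuot.mkAlgHom k (rel k N L g x gs) (ι k i)

/-- The image of a defining relation holds in the quotient. -/
theorem mk_rel {a b : FreeAlgebra k (Fin N)} (h : rel k N L g x gs a b) :
    RingQuot.mkAlgHom k (rel k N L g x gs) a = RingQuot.mkAlgHom k (rel k N L g x gs) b :=
  RingQuot.mkAlgHom_rel k h

/-- The homomorphism on the free algebra inducing `ν_I`. -/
def preNu : FreeAlgebra k (Fin N) →ₐ[k] Diff k N L g x gs :=
  FreeAlgebra.lift k (fun i => D k N L g x gs i - (g⁻¹ * x i) • (1 : Diff k N L g x gs))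

theorem preNu_rel (hx : ∀ s : Fin N, L ≤ (s : ℕ) → x s = 0)
    ⦃a b : FreeAlgebra k (Fin N)⦄ (h : rel k N L g x gs a b) :
    preNu k N L g x gs a = preNu k N L g x gs b := by
  have key := mk_rel k N L g x gs h
  rcases h with ⟨i, j, -, -, rfl, rfl⟩ | ⟨i, s, -, hs, rfl, rfl⟩ | ⟨s, l, hs, hl, rfl, rfl⟩
  · simp only [map_add, map_sub, map_smul, map_mul] at key
    change g • (D k N L g x gs i * D k N L g x gs j) = g • (D k N L g x gs j * D k N L g x gs i)
      + x j • D k N L g x gs i - x i • D k N L g x gs j at key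
    simp only [preNu, map_add, map_sub, map_smul, map_mul, FreeAlgebra.lift_ι_apply]
    simp only [sub_mul, mul_sub, smul_sub, key, mul_smul_comm, smul_mul_assoc, mul_one, one_mul]
    module
  · simp only [map_add, map_sub, map_smul, map_mul] at key
    change gs s • (D k N L g x gs s * D k N L g x gs i) =
      gs s • (D k N L g x gs i * D k N L g x gs s) + x i • D k N L g x gs s at key
    simp only [preNu, map_add, map_sub, map_smul, map_mul, FreeAlgebra.lift_ι_apply, hx s hs]
    simp only [sub_mul, mul_sub, smul_sub, key, mul_smul_comm, smul_mul_assoc, mul_one, one_mul,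
      mul_zero, zero_smul, sub_zero]
    module
  · simp only [map_mul] at key
    change D k N L g x gs s * D k N L g x gs l = D k N L g x gs l * D k N L g x gs s at key
    simp only [preNu, map_mul, FreeAlgebra.lift_ι_apply, hx s hs, hx l (by omega),
      mul_zero, zero_smul, sub_zero, key]

/-- There exists a unique `k`-algebra homomorphism
`ν_I : 𝒟 → 𝒟` with `ν_I(D_j) = D_j − g⁻¹·x_j` for `j ∈ I` and
`ν_I(D_s) = D_s` for `s ∈ S`. -/
theorem existsUnique_nuI (hL : 3 ≤ L) (hLN : L ≤ N) (hg : g ≠ 0)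
    (hx : ∀ s : Fin N, L ≤ (s : ℕ) → x s = 0)
    (hgs : ∀ s : Fin N, L ≤ (s : ℕ) → gs s ≠ 0) :
    ∃! ν : Diff k N L g x gs →ₐ[k] Diff k N L g x gs,
      (∀ j : Fin N, (j : ℕ) < L →
        ν (D k N L g x gs j) = D k N L g x gs j - (g⁻¹ * x j) • 1) ∧
      (∀ s : Fin N, L ≤ (s : ℕ) → ν (D k N L g x gs s) = D k N L g x gs s) := by
  have hν : ∀ i, RingQuot.liftAlgHom k ⟨preNu k N L g x gs, preNu_rel k N L g x gs hx⟩
      (D k N L g x gs i) = D k N L g x gs i - (g⁻¹ * x i) • 1 := by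
    intro i
    rw [D, RingQuot.liftAlgHom_mkAlgHom_apply]
    simp [preNu, D]
  refine ⟨RingQuot.liftAlgHom k ⟨preNu k N L g x gs, preNu_rel k N L g x gs hx⟩,
    ⟨fun j _ => hν j, fun s hs => ?_⟩, ?_⟩
  · rw [hν, hx s hs, mul_zero, zero_smul, sub_zero]
  · rintro μ ⟨h1, h2⟩
    apply RingQuot.ringQuot_ext'
    apply FreeAlgebra.hom_ext
    funext i
    change μ (D k N L g x gs i) = RingQuot.liftAlgHom k _ (D k N L g x gs i)
    rw [hν]
    by_cases hi : (i : ℕ) < L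
    · exact h1 i hi
    · rw [h2 i (by omega), hx i (by omega), mul_zero, zero_smul, sub_zero]

end DiffusionAI
end
end

section
/- For each s with L < s ≤ N there exists a unique k-algebra homomorphism ν_s : 𝒟 → 𝒟 satisfying ν_s(D_i) = D_i − g_s⁻¹·x_i for all 1 ≤ i ≤ L and ν_s(D_l) = D_l for all L < l ≤ N. -/
/-!
The diffusion algebra of type `A_I` on `N` generators over a field `k`,
with `I = {0, …, L-1}` and `S = {L, …, N-1}` (a 0-indexed version of
`I = {1,…,L}`, `S = {L+1,…,N}`).  It is the quotient of the free associative
unital `k`-algebra on generators `D_0, …, D_{N-1}` by the two-sided ideal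
generated by the defining relations below.
-/

noncomputable section

namespace DiffusionAI

open FreeAlgebra

variable (k : Type*) [Field k] (N L : ℕ) (g : k) (x : Fin N → k) (gs : Fin N → k)

theorem D_rel₁ (i j : Fin N) (hij : (i : ℕ) < (j : ℕ)) (hj : (j : ℕ) < L) :
    g • (D k N L g x gs i * D k N L g x gs j) =
      g • (D k N L g x gs j * D k N L g x gs i) + x j • D k N L g x gs i
        - x i • D k N L g x gs j := by
  have h := RingQuot.mkAlgHom_rel k (s := rel k N L g x gs)
    (Or.inl ⟨i, j, hij, hj, rfl, rfl⟩)
  simp only [map_sub, map_add, map_smul, map_mul] at h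
  exact h

theorem D_rel₂ (i s : Fin N) (hi : (i : ℕ) < L) (hs : L ≤ (s : ℕ)) :
    gs s • (D k N L g x gs s * D k N L g x gs i) =
      gs s • (D k N L g x gs i * D k N L g x gs s) + x i • D k N L g x gs s := by
  have h := RingQuot.mkAlgHom_rel k (s := rel k N L g x gs)
    (Or.inr (Or.inl ⟨i, s, hi, hs, rfl, rfl⟩))
  simp only [map_sub, map_add, map_smul, map_mul] at h
  exact h

theorem D_rel₃ (s l : Fin N) (hs : L ≤ (s : ℕ)) (hl : (s : ℕ) < (l : ℕ)) :
    D k N L g x gs s * D k N L g x gs l = D k N L g x gs l * D k N L g x gs s := by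
  have h := RingQuot.mkAlgHom_rel k (s := rel k N L g x gs)
    (Or.inr (Or.inr ⟨s, l, hs, hl, rfl, rfl⟩))
  simp only [map_sub, map_add, map_smul, map_mul] at h
  exact h

theorem shift_comm {A : Type*} [Ring A] [Algebra k A] (a b : A) (p q : k) :
    (a - p • 1) * (b - q • 1) = a * b - q • a - p • b + (p * q) • (1 : A) := by
  simp only [sub_mul, mul_sub, smul_mul_assoc, mul_smul_comm, one_mul, mul_one, smul_smul,
    smul_sub]
  module

/-- For each `s ∈ S` there exists a unique `k`-algebra
homomorphism `ν_s : 𝒟 → 𝒟` with `ν_s(D_i) = D_i − g_s⁻¹·x_i` for `i ∈ I` and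
`ν_s(D_l) = D_l` for `l ∈ S`. -/
theorem existsUnique_nuS (hL : 3 ≤ L) (hLN : L ≤ N) (hg : g ≠ 0)
    (hx : ∀ s : Fin N, L ≤ (s : ℕ) → x s = 0)
    (hgs : ∀ s : Fin N, L ≤ (s : ℕ) → gs s ≠ 0) :
    ∀ s : Fin N, L ≤ (s : ℕ) →
      ∃! ν : Diff k N L g x gs →ₐ[k] Diff k N L g x gs,
        (∀ i : Fin N, (i : ℕ) < L →
          ν (D k N L g x gs i) = D k N L g x gs i - ((gs s)⁻¹ * x i) • 1) ∧
        (∀ l : Fin N, L ≤ (l : ℕ) → ν (D k N L g x gs l) = D k N L g x gs l) := by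
  intro s hs
  set c := (gs s)⁻¹ with hc
  let f : FreeAlgebra k (Fin N) →ₐ[k] Diff k N L g x gs :=
    FreeAlgebra.lift k (fun i => D k N L g x gs i - (c * x i) • 1)
  have hf : ∀ i, f (ι k i) = D k N L g x gs i - (c * x i) • 1 := fun i => by
    simp [f]
  have hrel : ∀ ⦃a b⦄, rel k N L g x gs a b → f a = f b := by
    rintro a b (⟨i, j, hij, hj, rfl, rfl⟩ | ⟨i, t, hi, ht, rfl, rfl⟩ | ⟨t, l, ht, hl, rfl, rfl⟩)
    · simp only [map_sub, map_add, map_smul, map_mul, hf]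
      have h := D_rel₁ k N L g x gs i j hij hj
      rw [shift_comm, shift_comm, smul_add, smul_sub, smul_sub, h]
      module
    · simp only [map_add, map_smul, map_mul, hf]
      have h := D_rel₂ k N L g x gs i t hi ht
      rw [shift_comm, shift_comm, smul_add, smul_sub, smul_sub, h, hx t ht]
      module
    · simp only [map_mul, hf]
      rw [hx t ht, hx l (by omega), mul_zero, zero_smul, sub_zero, sub_zero]
      exact D_rel₃ k N L g x gs t l ht hl
  refine ⟨RingQuot.liftAlgHom k ⟨f, hrel⟩, ⟨fun i _ => ?_, fun l hl => ?_⟩, ?_⟩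
  · rw [← hf]
    exact RingQuot.liftAlgHom_mkAlgHom_apply k f hrel _
  · have h : f (ι k l) = D k N L g x gs l := by simp [hf, hx l hl]
    conv_rhs => rw [← h]
    exact RingQuot.liftAlgHom_mkAlgHom_apply k f hrel _
  · rintro μ ⟨h1, h2⟩
    apply RingQuot.ringQuot_ext'
    apply FreeAlgebra.hom_ext
    funext i
    have e : μ (D k N L g x gs i) = f (ι k i) := by
      by_cases hi : (i : ℕ) < L
      · rw [h1 i hi, hf]
      · rw [h2 i (by omega), hf, hx i (by omega), mul_zero, zero_smul, sub_zero]
    exact e.trans (RingQuot.liftAlgHom_mkAlgHom_apply k f hrel _).symm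


end DiffusionAI
end
end

section
/- For every a ∈ {1,…,N} there exists a unique k-linear map ∂_a : 𝒟 → 𝒟 such that ∂_a(D_b) = 1 if b = a, ∂_a(D_b) = 0 if b ≠ a, and ∂_a(p·q) = ∂_a(p)·q + ν_a(p)·∂_a(q) for all p, q ∈ 𝒟. -/
/-!
The diffusion algebra of type `A_I` on `N` generators over a field `k`,
with `I = {0, …, L-1}` and `S = {L, …, N-1}` (a 0-indexed version of
`I = {1,…,L}`, `S = {L+1,…,N}`).  It is the quotient of the free associative
unital `k`-algebra on generators `D_0, …, D_{N-1}` by the two-sided ideal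
generated by the defining relations below.
-/

noncomputable section

namespace DiffusionAI

open FreeAlgebra

variable (k : Type*) [Field k] (N L : ℕ) (g : k) (x : Fin N → k) (gs : Fin N → k)

/-- The defining property of the `k`-algebra endomorphism `ν_I` of `𝒟`:
`ν_I(D_j) = D_j − g⁻¹·x_j` for `j ∈ I` and `ν_I(D_s) = D_s` for `s ∈ S`. -/
def IsNuI (ν : Diff k N L g x gs →ₐ[k] Diff k N L g x gs) : Prop :=
  (∀ j : Fin N, (j : ℕ) < L →
    ν (D k N L g x gs j) = D k N L g x gs j - (g⁻¹ * x j) • 1) ∧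
  (∀ s : Fin N, L ≤ (s : ℕ) → ν (D k N L g x gs s) = D k N L g x gs s)

/-- The defining property of the `k`-algebra endomorphism `ν_s` of `𝒟` (`s ∈ S`):
`ν_s(D_i) = D_i − g_s⁻¹·x_i` for `i ∈ I` and `ν_s(D_l) = D_l` for `l ∈ S`. -/
def IsNuS (s : Fin N) (ν : Diff k N L g x gs →ₐ[k] Diff k N L g x gs) : Prop :=
  (∀ i : Fin N, (i : ℕ) < L →
    ν (D k N L g x gs i) = D k N L g x gs i - ((gs s)⁻¹ * x i) • 1) ∧
  (∀ l : Fin N, L ≤ (l : ℕ) → ν (D k N L g x gs l) = D k N L g x gs l)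

/-- `ν_a` is `ν_I` for `a ∈ I` and `ν_a` for `a ∈ S`. -/
def IsNu (a : Fin N) (ν : Diff k N L g x gs →ₐ[k] Diff k N L g x gs) : Prop :=
  if (a : ℕ) < L then IsNuI k N L g x gs ν else IsNuS k N L g x gs a ν

/-- The defining property of the twisted partial derivative `∂_a : 𝒟 → 𝒟`
(relative to the endomorphism `ν = ν_a`): it is `k`-linear, `∂_a(D_b) = δ_{ab}·1`,
and `∂_a(p·q) = ∂_a(p)·q + ν_a(p)·∂_a(q)` for all `p, q ∈ 𝒟`. -/
def IsPartial (a : Fin N) (ν : Diff k N L g x gs →ₐ[k] Diff k N L g x gs)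
    (pd : Diff k N L g x gs →ₗ[k] Diff k N L g x gs) : Prop :=
  (∀ b : Fin N, pd (D k N L g x gs b) = if b = a then 1 else 0) ∧
  ∀ p q : Diff k N L g x gs, pd (p * q) = pd p * q + ν p * pd q

/-- Induction principle for the diffusion algebra. -/
theorem Diff.ind {P : Diff k N L g x gs → Prop}
    (h1 : ∀ r : k, P (algebraMap k _ r)) (hD : ∀ i, P (D k N L g x gs i))
    (hm : ∀ a b, P a → P b → P (a * b)) (ha : ∀ a b, P a → P b → P (a + b)) (p) : P p := by
  obtain ⟨p, rfl⟩ := RingQuot.mkAlgHom_surjective k (rel k N L g x gs) p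
  induction p using FreeAlgebra.induction with
  | grade0 r => rw [AlgHom.commutes]; exact h1 r
  | grade1 i => exact hD i
  | mul a b iha ihb => rw [map_mul]; exact hm _ _ iha ihb
  | add a b iha ihb => rw [map_add]; exact ha _ _ iha ihb

/-- The triangular matrix lift on the free algebra. -/
def F (a : Fin N) (ν : Diff k N L g x gs →ₐ[k] Diff k N L g x gs) :
    FreeAlgebra k (Fin N) →ₐ[k] Matrix (Fin 2) (Fin 2) (Diff k N L g x gs) :=
  FreeAlgebra.lift k fun b =>
    !![ν (D k N L g x gs b), if b = a then 1 else 0; 0, D k N L g x gs b]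

theorem F_entries (a : Fin N) (ν : Diff k N L g x gs →ₐ[k] Diff k N L g x gs)
    (p : FreeAlgebra k (Fin N)) :
    F k N L g x gs a ν p 1 0 = 0 ∧
    F k N L g x gs a ν p 0 0 = ν (RingQuot.mkAlgHom k (rel k N L g x gs) p) ∧
    F k N L g x gs a ν p 1 1 = RingQuot.mkAlgHom k (rel k N L g x gs) p := by
  induction p using FreeAlgebra.induction with
  | grade0 r => simp [AlgHom.commutes, Matrix.algebraMap_matrix_apply]
  | grade1 i => simp [F, D]
  | mul a b iha ihb =>
    obtain ⟨h1, h2, h3⟩ := iha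
    obtain ⟨h4, h5, h6⟩ := ihb
    simp [Matrix.mul_apply, Fin.sum_univ_two, h1, h2, h3, h4, h5, h6]
  | add a b iha ihb =>
    obtain ⟨h1, h2, h3⟩ := iha
    obtain ⟨h4, h5, h6⟩ := ihb
    simp [h1, h2, h3, h4, h5, h6]

theorem F_mul01 (a : Fin N) (ν : Diff k N L g x gs →ₐ[k] Diff k N L g x gs)
    (p q : FreeAlgebra k (Fin N)) :
    F k N L g x gs a ν (p * q) 0 1 =
      ν (RingQuot.mkAlgHom k (rel k N L g x gs) p) * F k N L g x gs a ν q 0 1 +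
      F k N L g x gs a ν p 0 1 * RingQuot.mkAlgHom k (rel k N L g x gs) q := by
  rw [map_mul, Matrix.mul_apply, Fin.sum_univ_two, (F_entries k N L g x gs a ν p).2.1,
    (F_entries k N L g x gs a ν q).2.2]

theorem F_gen01 (a : Fin N) (ν : Diff k N L g x gs →ₐ[k] Diff k N L g x gs) (b : Fin N) :
    F k N L g x gs a ν (ι k b) 0 1 = if b = a then 1 else 0 := by
  simp [F]

theorem F_rel (hg : g ≠ 0)
    (hgs : ∀ s : Fin N, L ≤ (s : ℕ) → gs s ≠ 0)
    (a : Fin N) (ν : Diff k N L g x gs →ₐ[k] Diff k N L g x gs)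
    (hν : IsNu k N L g x gs a ν) (p q : FreeAlgebra k (Fin N))
    (h : rel k N L g x gs p q) : F k N L g x gs a ν p = F k N L g x gs a ν q := by
  have hpq := RingQuot.mkAlgHom_rel k h
  have h01 : F k N L g x gs a ν p 0 1 = F k N L g x gs a ν q 0 1 := by
    have hD : ∀ i, RingQuot.mkAlgHom k (rel k N L g x gs) (ι k i) = D k N L g x gs i :=
      fun _ => rfl
    rcases h with ⟨i, j, hij, hj, rfl, rfl⟩ | ⟨i, s, hi, hs, rfl, rfl⟩ | ⟨s, l, hs, hl, rfl, rfl⟩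
    · have hne : i ≠ j := by rintro rfl; omega
      simp only [map_add, map_sub, map_smul, Matrix.add_apply, Matrix.sub_apply,
        Matrix.smul_apply, F_mul01, F_gen01, hD]
      by_cases haL : (a : ℕ) < L
      · rw [IsNu, if_pos haL] at hν
        rw [hν.1 i (by omega), hν.1 j hj]
        by_cases h1 : i = a
        · subst h1
          simp [hne.symm, smul_sub, smul_smul, hg]
        · by_cases h2 : j = a
          · subst h2
            simp [hne, smul_sub, smul_smul, hg]
          · simp [h1, h2]
      · have h1 : i ≠ a := by rintro rfl; omega
        have h2 : j ≠ a := by rintro rfl; omega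
        simp [h1, h2]
    · have hne : i ≠ s := by rintro rfl; omega
      simp only [map_add, map_sub, map_smul, Matrix.add_apply, Matrix.sub_apply,
        Matrix.smul_apply, F_mul01, F_gen01, hD]
      by_cases haL : (a : ℕ) < L
      · rw [IsNu, if_pos haL] at hν
        have h2 : s ≠ a := by rintro rfl; omega
        rw [hν.1 i hi, hν.2 s hs]
        by_cases h1 : i = a
        · simp [h1, h2]
        · simp [h1, h2]
      · rw [IsNu, if_neg haL] at hν
        have h1 : i ≠ a := by rintro rfl; omega
        rw [hν.1 i hi, hν.2 s hs]
        by_cases h2 : s = a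
        · subst h2
          simp [hne, smul_sub, smul_smul, hgs s hs]
        · simp [h1, h2]
    · have hne : s ≠ l := by rintro rfl; omega
      have e : ∀ t : Fin N, L ≤ (t : ℕ) → ν (D k N L g x gs t) = D k N L g x gs t := by
        intro t ht
        rw [IsNu] at hν
        split_ifs at hν
        · exact hν.2 t ht
        · exact hν.2 t ht
      simp only [F_mul01, F_gen01, hD]
      rw [e s hs, e l (by omega)]
      by_cases h1 : s = a
      · subst h1
        simp [hne.symm]
      · by_cases h2 : l = a
        · subst h2
          simp [hne]
        · simp [h1, h2]
  obtain ⟨h1, h2, h3⟩ := F_entries k N L g x gs a ν p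
  obtain ⟨h4, h5, h6⟩ := F_entries k N L g x gs a ν q
  ext i j
  fin_cases i <;> fin_cases j
  · exact h2.trans ((congrArg ν hpq).trans h5.symm)
  · exact h01
  · exact h1.trans h4.symm
  · exact h3.trans (hpq.trans h6.symm)

/-- For every `a ∈ {1,…,N}` there exists a unique `k`-linear
map `∂_a : 𝒟 → 𝒟` with `∂_a(D_b) = δ_{ab}·1` and satisfying the `ν_a`-twisted
Leibniz rule `∂_a(p·q) = ∂_a(p)·q + ν_a(p)·∂_a(q)`. -/
theorem existsUnique_partial (hL : 3 ≤ L) (hLN : L ≤ N) (hg : g ≠ 0)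
    (hx : ∀ s : Fin N, L ≤ (s : ℕ) → x s = 0)
    (hgs : ∀ s : Fin N, L ≤ (s : ℕ) → gs s ≠ 0) :
    ∀ a : Fin N, ∀ ν : Diff k N L g x gs →ₐ[k] Diff k N L g x gs,
      IsNu k N L g x gs a ν →
      ∃! pd : Diff k N L g x gs →ₗ[k] Diff k N L g x gs,
        IsPartial k N L g x gs a ν pd := by
  intro a ν hν
  let φ : Diff k N L g x gs →ₐ[k] Matrix (Fin 2) (Fin 2) (Diff k N L g x gs) :=
    RingQuot.liftAlgHom k ⟨F k N L g x gs a ν, fun p q h => F_rel k N L g x gs hg hgs a ν hν p q h⟩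
  have hφ : ∀ p, φ (RingQuot.mkAlgHom k (rel k N L g x gs) p) = F k N L g x gs a ν p :=
    fun p => RingQuot.liftAlgHom_mkAlgHom_apply k _ _ _
  let pd : Diff k N L g x gs →ₗ[k] Diff k N L g x gs :=
    { toFun := fun p => φ p 0 1
      map_add' := fun p q => by simp
      map_smul' := fun r p => by simp }
  have hpd : IsPartial k N L g x gs a ν pd := by
    refine ⟨fun b => ?_, fun p q => ?_⟩
    · change φ (RingQuot.mkAlgHom k (rel k N L g x gs) (ι k b)) 0 1 = _
      rw [hφ, F_gen01]
    · obtain ⟨p, rfl⟩ := RingQuot.mkAlgHom_surjective k (rel k N L g x gs) p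
      obtain ⟨q, rfl⟩ := RingQuot.mkAlgHom_surjective k (rel k N L g x gs) q
      change φ _ 0 1 = φ _ 0 1 * _ + _ * φ _ 0 1
      rw [← map_mul, hφ, hφ, hφ, F_mul01, add_comm]
  refine ⟨pd, hpd, fun pd' hpd' => ?_⟩
  have hone : ∀ d, IsPartial k N L g x gs a ν d → d 1 = 0 := by
    intro d hd
    have := hd.2 1 1
    simpa using this
  ext p
  induction p using Diff.ind with
  | h1 r => rw [Algebra.algebraMap_eq_smul_one, map_smul, map_smul, hone _ hpd, hone _ hpd']
  | hD i => rw [hpd.1, hpd'.1]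
  | hm p q hp hq => rw [hpd.2, hpd'.2, hp, hq]
  | ha p q hp hq => rw [map_add, map_add, hp, hq]

end DiffusionAI
end
end

section
/- For every a ∈ {1,…,N} and every (k_1,…,k_N) ∈ ℕ^N the twisted partial derivative of the ordered monomial is given by: if k_a = 0 then ∂_a(D_1^{k_1}·D_2^{k_2}·…·D_N^{k_N}) = 0, and if k_a ≥ 1 then ∂_a(D_1^{k_1}·…·D_N^{k_N}) = (∏_{j=1}^{a−1} (D_j − c_a·x_j)^{k_j}) · (∑_{m=0}^{k_a−1} (D_a − c_a·x_a)^m · D_a^{k_a−1−m}) · D_{a+1}^{k_{a+1}}·…·D_N^{k_N}, where c_a := g⁻¹ if a ≤ L and c_a := g_a⁻¹ if a > L (in particular, since x_a = 0 for a > L, the middle factor equals k_a·D_a^{k_a−1} when a > L). -/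
/-!
The diffusion algebra of type `A_I` on `N` generators over a field `k`,
with `I = {0, …, L-1}` and `S = {L, …, N-1}` (a 0-indexed version of
`I = {1,…,L}`, `S = {L+1,…,N}`).  It is the quotient of the free associative
unital `k`-algebra on generators `D_0, …, D_{N-1}` by the two-sided ideal
generated by the defining relations below.
-/

noncomputable section

namespace DiffusionAI

open FreeAlgebra

variable (k : Type*) [Field k] (N L : ℕ) (g : k) (x : Fin N → k) (gs : Fin N → k)

/-- The ordered monomial `D_0^{K_0}·D_1^{K_1}·⋯·D_{N-1}^{K_{N-1}}` in `𝒟`. -/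
def monomial (K : Fin N → ℕ) : Diff k N L g x gs :=
  ((List.finRange N).map (fun i => D k N L g x gs i ^ K i)).prod

/-- The scalar `c_a`: it is `g⁻¹` for `a ∈ I` and `g_a⁻¹` for `a ∈ S`. -/
def coeff (a : Fin N) : k := if (a : ℕ) < L then g⁻¹ else (gs a)⁻¹

/-- A twisted derivation kills `1`. -/
theorem tw_one {A : Type*} [Ring A] (ν : A →+* A) (pd : A → A)
    (h : ∀ p q, pd (p * q) = pd p * q + ν p * pd q) : pd 1 = 0 := by
  have := h 1 1
  simpa using this

theorem tw_pow_zero {A : Type*} [Ring A] (ν : A →+* A) (pd : A → A)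
    (h : ∀ p q, pd (p * q) = pd p * q + ν p * pd q) (d : A) (hd : pd d = 0) (n : ℕ) :
    pd (d ^ n) = 0 := by
  induction n with
  | zero => simpa using tw_one ν pd h
  | succ n ih => rw [pow_succ, h, ih, hd]; simp

theorem tw_pow {A : Type*} [Ring A] (ν : A →+* A) (pd : A → A)
    (h : ∀ p q, pd (p * q) = pd p * q + ν p * pd q) (d : A) (hd : pd d = 1) (n : ℕ) :
    pd (d ^ n) = ∑ m ∈ Finset.range n, ν d ^ m * d ^ (n - 1 - m) := by
  induction n with
  | zero => simpa using tw_one ν pd h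
  | succ n ih =>
    rw [pow_succ', h, ih, hd, Finset.sum_range_succ', Finset.mul_sum, add_comm]
    congr 1
    · refine Finset.sum_congr rfl fun m _ => ?_
      rw [pow_succ', mul_assoc, show n + 1 - 1 - (m + 1) = n - 1 - m by omega]
    · simp

theorem tw_list {A : Type*} [Ring A] (ν : A →+* A) (pd : A → A)
    (h : ∀ p q, pd (p * q) = pd p * q + ν p * pd q) (l : List A) (hl : ∀ d ∈ l, pd d = 0) :
    pd l.prod = 0 := by
  induction l with
  | nil => simpa using tw_one ν pd h
  | cons d l ih =>
    rw [List.prod_cons, h, hl d (by simp), ih fun e he => hl e (by simp [he])]; simp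

/-- The twisted partial derivative of an ordered monomial:
if `K_a = 0` then `∂_a(D_1^{K_1}⋯D_N^{K_N}) = 0`, and if `K_a ≥ 1` then
`∂_a(D_1^{K_1}⋯D_N^{K_N}) = (∏_{j<a} (D_j − c_a·x_j)^{K_j}) ·
(∑_{m=0}^{K_a−1} (D_a − c_a·x_a)^m · D_a^{K_a−1−m}) · ∏_{j>a} D_j^{K_j}`. -/
theorem partial_monomial (hL : 3 ≤ L) (hLN : L ≤ N) (hg : g ≠ 0)
    (hx : ∀ s : Fin N, L ≤ (s : ℕ) → x s = 0)
    (hgs : ∀ s : Fin N, L ≤ (s : ℕ) → gs s ≠ 0)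
    (a : Fin N) (ν : Diff k N L g x gs →ₐ[k] Diff k N L g x gs)
    (hν : IsNu k N L g x gs a ν)
    (pd : Diff k N L g x gs →ₗ[k] Diff k N L g x gs)
    (hpd : IsPartial k N L g x gs a ν pd) (K : Fin N → ℕ) :
    (K a = 0 → pd (monomial k N L g x gs K) = 0) ∧
    (1 ≤ K a →
      pd (monomial k N L g x gs K) =
        (((List.finRange N).take (a : ℕ)).map
            (fun j => (D k N L g x gs j - (coeff k N L g gs a * x j) • 1) ^ K j)).prod *
        (∑ m ∈ Finset.range (K a),
            (D k N L g x gs a - (coeff k N L g gs a * x a) • 1) ^ m *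
              D k N L g x gs a ^ (K a - 1 - m)) *
        (((List.finRange N).drop ((a : ℕ) + 1)).map
            (fun j => D k N L g x gs j ^ K j)).prod) := by
  obtain ⟨h1, h⟩ := hpd
  have hνD : ∀ j, ν (D k N L g x gs j) =
      D k N L g x gs j - (coeff k N L g gs a * x j) • 1 := by
    intro j
    unfold IsNu IsNuI IsNuS at hν
    unfold coeff
    by_cases haL : (a : ℕ) < L
    · rw [if_pos haL] at hν ⊢
      by_cases hj : (j : ℕ) < L
      · exact hν.1 j hj
      · rw [hν.2 j (not_lt.mp hj), hx j (not_lt.mp hj)]; simp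
    · rw [if_neg haL] at hν ⊢
      by_cases hj : (j : ℕ) < L
      · exact hν.1 j hj
      · rw [hν.2 j (not_lt.mp hj), hx j (not_lt.mp hj)]; simp
  have hlen : (a : ℕ) < (List.finRange N).length := by simp
  have hsplit : List.finRange N = (List.finRange N).take (a : ℕ) ++
      a :: (List.finRange N).drop ((a : ℕ) + 1) := by
    conv_lhs => rw [← List.take_append_drop (a : ℕ) (List.finRange N),
      List.drop_eq_getElem_cons hlen]
    simp
  have hnd := List.nodup_finRange N
  rw [hsplit] at hnd
  have hnd' := List.nodup_middle.mp hnd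
  rw [List.nodup_cons, List.mem_append, not_or] at hnd'
  obtain ⟨⟨hP, hQ⟩, -⟩ := hnd'
  have key : ∀ l : List (Fin N), a ∉ l →
      pd ((l.map fun i => D k N L g x gs i ^ K i).prod) = 0 := by
    intro l hl
    refine tw_list (ν : _ →+* _) pd h _ fun d hd => ?_
    obtain ⟨i, hi, rfl⟩ := List.mem_map.mp hd
    refine tw_pow_zero (ν : _ →+* _) pd h _ ?_ _
    rw [h1, if_neg]
    rintro rfl
    exact hl hi
  have main : pd (monomial k N L g x gs K) =
        (((List.finRange N).take (a : ℕ)).map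
            (fun j => (D k N L g x gs j - (coeff k N L g gs a * x j) • 1) ^ K j)).prod *
        (∑ m ∈ Finset.range (K a),
            (D k N L g x gs a - (coeff k N L g gs a * x a) • 1) ^ m *
              D k N L g x gs a ^ (K a - 1 - m)) *
        (((List.finRange N).drop ((a : ℕ) + 1)).map
            (fun j => D k N L g x gs j ^ K j)).prod := by
    have hp := tw_pow (ν : _ →+* _) pd h (D k N L g x gs a) (by rw [h1, if_pos rfl]) (K a)
    have hm : monomial k N L g x gs K =
        (((List.finRange N).take (a : ℕ)).map (fun j => D k N L g x gs j ^ K j)).prod *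
        (D k N L g x gs a ^ K a *
        (((List.finRange N).drop ((a : ℕ) + 1)).map
            (fun j => D k N L g x gs j ^ K j)).prod) := by
      unfold monomial
      conv_lhs => rw [hsplit]
      rw [List.map_append, List.prod_append, List.map_cons, List.prod_cons]
    rw [hm, h, h, key _ hP, key _ hQ, hp, map_list_prod, List.map_map]
    simp only [zero_mul, mul_zero, zero_add, add_zero, Function.comp_def, map_pow, hνD,
      RingHom.coe_coe, mul_assoc]
  refine ⟨fun h0 => ?_, fun _ => main⟩
  rw [main, h0]
  simp

end DiffusionAI
end
end

section
/- Assume char k = 0 and assume the family of ordered monomials (D_1^{k_1}·D_2^{k_2}·…·D_N^{k_N})_{(k_1,…,k_N) ∈ ℕ^N} is a k-vector space basis of 𝒟 (PBW basis). If p ∈ 𝒟 satisfies ∂_a(p) = 0 for every a ∈ {1,…,N}, then p is a scalar multiple of the identity, i.e. p ∈ k·1. -/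
/-!
The diffusion algebra of type `A_I` on `N` generators over a field `k`,
with `I = {0, …, L-1}` and `S = {L, …, N-1}` (a 0-indexed version of
`I = {1,…,L}`, `S = {L+1,…,N}`).  It is the quotient of the free associative
unital `k`-algebra on generators `D_0, …, D_{N-1}` by the two-sided ideal
generated by the defining relations below.
-/

noncomputable section

namespace DiffusionAI

open FreeAlgebra

variable (k : Type*) [Field k] (N L : ℕ) (g : k) (x : Fin N → k) (gs : Fin N → k)

section Helpers

open Polynomial

/-- The one-variable polynomial expressing the twisted derivative of the `n`-th power. -/
def epoly {k : Type*} [Field k] (c : k) : ℕ → k[X]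
  | 0 => 0
  | n + 1 => X ^ n + (X - C c) * epoly c n

theorem epoly_coeff {k : Type*} [Field k] (c : k) (n : ℕ) :
    (∀ m, n ≤ m → (epoly c n).coeff m = 0) ∧ (epoly c (n + 1)).coeff n = (n : k) + 1 := by
  have key : ∀ n m, (epoly c (n + 1)).coeff m = (if m = n then 1 else 0) +
      ((X * epoly c n).coeff m - c * (epoly c n).coeff m) := by
    intro n m
    simp only [epoly, sub_mul, coeff_add, coeff_sub, coeff_X_pow, coeff_C_mul]
  induction n with
  | zero =>
    refine ⟨fun m _ => by simp [epoly], ?_⟩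
    rw [key]; simp [epoly]
  | succ n ih =>
    have h1 : ∀ m, n + 1 ≤ m → (epoly c (n + 1)).coeff m = 0 := by
      intro m hm
      obtain ⟨m, rfl⟩ : ∃ m', m = m' + 1 := ⟨m - 1, by omega⟩
      rw [key, coeff_X_mul, ih.1 m (by omega), ih.1 (m + 1) (by omega), if_neg (by omega)]
      simp
    refine ⟨h1, ?_⟩
    rw [key, coeff_X_mul, ih.2, h1 _ le_rfl]
    push_cast
    simp
    ring

theorem pow_coeff_gt {k : Type*} [Field k] (c : k) (n m : ℕ) (h : n < m) :
    ((X - C c : k[X]) ^ n).coeff m = 0 := by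
  apply coeff_eq_zero_of_natDegree_lt
  rw [natDegree_pow, natDegree_X_sub_C]; omega

theorem pow_coeff_self {k : Type*} [Field k] (c : k) (n : ℕ) :
    ((X - C c : k[X]) ^ n).coeff n = 1 := by
  have h := ((monic_X_sub_C c).pow n).coeff_natDegree
  rwa [natDegree_pow, natDegree_X_sub_C, mul_one] at h

theorem twisted_prod_zero {A ι : Type*} [Ring A] (ν pd : A → A)
    (h1 : pd 1 = 0) (hm : ∀ p q, pd (p * q) = pd p * q + ν p * pd q) (f : ι → A)
    (l : List ι) (hl : ∀ i ∈ l, pd (f i) = 0) : pd (l.map f).prod = 0 := by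
  induction l with
  | nil => simpa using h1
  | cons b l ih =>
    rw [List.map_cons, List.prod_cons, hm, hl b (by simp),
      ih (fun i hi => hl i (by simp [hi]))]
    simp

theorem twisted_prod {A ι : Type*} [Ring A] [LinearOrder ι] (ν pd : A → A)
    (h1 : pd 1 = 0) (hm : ∀ p q, pd (p * q) = pd p * q + ν p * pd q) (f : ι → A) (a : ι)
    (hf : ∀ i, i ≠ a → pd (f i) = 0)
    (l : List ι) (hl : l.Pairwise (· < ·)) (ha : a ∈ l) :
    pd (l.map f).prod =
      (l.map (fun i => if i < a then ν (f i) else if i = a then pd (f i) else f i)).prod := by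
  induction l with
  | nil => simp at ha
  | cons b l ih =>
    rw [List.pairwise_cons] at hl
    rw [List.map_cons, List.prod_cons, hm, List.map_cons, List.prod_cons]
    by_cases hb : b = a
    · subst hb
      rw [twisted_prod_zero ν pd h1 hm f l (fun i hi => hf i (hl.1 i hi).ne')]
      have : l.map (fun i => if i < b then ν (f i) else if i = b then pd (f i) else f i)
          = l.map f := by
        apply List.map_congr_left
        intro i hi
        have := hl.1 i hi
        simp [this.not_gt, this.ne']
      rw [this]
      simp
    · have hal : a ∈ l := by
        rcases List.mem_cons.1 ha with h | h
        · exact absurd h.symm hb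
        · exact h
      rw [hf b hb, ih hl.2 hal, if_pos (hl.1 a hal)]
      simp

theorem repr_prod {k A : Type*} [Field k] [Ring A] [Algebra k A] (N : ℕ) (d : Fin N → A)
    (b : Module.Basis (Fin N → ℕ) k A)
    (hb : ∀ K, b K = ((List.finRange N).map (fun i => d i ^ K i)).prod)
    (q : Fin N → k[X]) (J : Fin N → ℕ) :
    b.repr (((List.finRange N).map (fun i => aeval (d i) (q i))).prod) J
      = ∏ i, (q i).coeff (J i) := by
  classical
  let Φ := (MultilinearMap.mkPiAlgebraFin k N A).compLinearMap
    (fun i => (aeval (R := k) (d i)).toLinearMap)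
  have hΦ : ∀ q, Φ q = ((List.finRange N).map (fun i => aeval (d i) (q i))).prod := by
    intro q
    simp [Φ, MultilinearMap.mkPiAlgebraFin_apply, List.ofFn_eq_map]
  have hq : q = fun i => ∑ n ∈ (q i).support, (q i).coeff n • (X ^ n : k[X]) := by
    funext i
    conv_lhs => rw [(q i).as_sum_support]
    simp [smul_eq_C_mul, C_mul_X_pow_eq_monomial]
  have hX : ∀ r : Fin N → ℕ, Φ (fun i => X ^ r i) = b r := by
    intro r
    rw [hΦ, hb]; simp
  have h2 : Φ q = ∑ r ∈ Fintype.piFinset (fun i => (q i).support),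
      (∏ i, (q i).coeff (r i)) • b r := by
    conv_lhs => rw [hq]
    rw [MultilinearMap.map_sum_finset]
    refine Finset.sum_congr rfl fun r _ => ?_
    rw [MultilinearMap.map_smul_univ, hX]
  rw [← hΦ, h2, map_sum, Finsupp.finsetSum_apply]
  simp only [map_smul, Module.Basis.repr_self, Finsupp.smul_apply, smul_eq_mul,
    Finsupp.single_apply, mul_ite, mul_one, mul_zero]
  rw [Finset.sum_ite_eq']
  split_ifs with h
  · rfl
  · simp only [Fintype.mem_piFinset, mem_support_iff, not_forall, not_not] at h
    obtain ⟨i, hi⟩ := h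
    exact (Finset.prod_eq_zero (Finset.mem_univ i) hi).symm

theorem abstract_main {k A : Type*} [Field k] [CharZero k] [Ring A] [Algebra k A] (N : ℕ)
    (d : Fin N → A) (b : Module.Basis (Fin N → ℕ) k A)
    (hb : ∀ K, b K = ((List.finRange N).map (fun i => d i ^ K i)).prod)
    (ν : Fin N → (A →ₐ[k] A)) (pd : Fin N → (A →ₗ[k] A))
    (c : Fin N → Fin N → k)
    (hν : ∀ a i, ν a (d i) = d i - algebraMap k A (c a i))
    (hpd : ∀ a i, pd a (d i) = if i = a then 1 else 0)
    (hm : ∀ a p q, pd a (p * q) = pd a p * q + ν a p * pd a q)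
    (p : A) (hp : ∀ a, pd a p = 0) : ∃ t : k, p = t • (1 : A) := by
  classical
  have h1 : ∀ a, pd a 1 = 0 := by
    intro a
    have := hm a 1 1
    simpa using this
  have hpow : ∀ a n, pd a (d a ^ n) = aeval (d a) (epoly (c a a) n) := by
    intro a n
    induction n with
    | zero => simp [epoly, h1]
    | succ n ih => simp [epoly, pow_succ', hm, ih, hν, hpd]
  have hpow0 : ∀ a i n, i ≠ a → pd a (d i ^ n) = 0 := by
    intro a i n hi
    induction n with
    | zero => simp [h1]
    | succ n ih => simp [pow_succ', hm, ih, hpd, hi]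
  let Q : Fin N → (Fin N → ℕ) → Fin N → k[X] := fun a K i =>
    if i < a then (X - C (c a i)) ^ K i else if i = a then epoly (c a a) (K a) else X ^ K i
  have hmon : ∀ a K J, b.repr (pd a (b K)) J = ∏ i, (Q a K i).coeff (J i) := by
    intro a K J
    rw [← repr_prod N d b hb, hb, twisted_prod (ν a) (pd a) (h1 a) (hm a) _ a
      (fun i hi => hpow0 a i _ hi) _ (List.pairwise_lt_finRange N) (List.mem_finRange a)]
    congr 4
    funext i
    simp only [Q]
    split_ifs with h h'
    · simp [hν]
    · subst h'; exact hpow _ _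
    · simp
  have hQ0 : ∀ a K i m, i ≠ a → K i < m → (Q a K i).coeff m = 0 := by
    intro a K i m hi hlt
    simp only [Q, if_neg hi]
    split_ifs
    · exact pow_coeff_gt _ _ _ hlt
    · rw [coeff_X_pow, if_neg (by omega)]
  have hQ1 : ∀ a K i, i ≠ a → (Q a K i).coeff (K i) = 1 := by
    intro a K i hi
    simp only [Q, if_neg hi]
    split_ifs
    · exact pow_coeff_self _ _
    · simp
  have hQa : ∀ a K, Q a K a = epoly (c a a) (K a) := by intro a K; simp [Q]
  have hsupp : ∀ K ∈ (b.repr p).support, K = 0 := by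
    by_contra! hcon
    obtain ⟨K1, hK1, hne⟩ := hcon
    obtain ⟨K0, hle, hmax⟩ := (b.repr p).support.exists_le_maximal hK1
    have hK0 : ∃ a, K0 a ≠ 0 := by
      by_contra! h
      exact hne (funext fun i => Nat.le_zero.1 ((hle i).trans (h i).le))
    obtain ⟨a, ha⟩ := hK0
    obtain ⟨n, hn⟩ := Nat.exists_eq_succ_of_ne_zero ha
    let J := Function.update K0 a n
    have hJ : ∀ i, i ≠ a → J i = K0 i := fun i hi => Function.update_of_ne hi _ _
    have hJa : J a = n := Function.update_self _ _ _
    have hsum : b.repr (pd a p) J =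
        ∑ K ∈ (b.repr p).support, b.repr p K * ∏ i, (Q a K i).coeff (J i) := by
      conv_lhs => rw [← b.linearCombination_repr p]
      rw [Finsupp.linearCombination_apply, Finsupp.sum, map_sum, map_sum,
        Finsupp.finsetSum_apply]
      refine Finset.sum_congr rfl fun K _ => ?_
      rw [map_smul, map_smul, Finsupp.smul_apply, hmon, smul_eq_mul]
    rw [hp a, Finset.sum_eq_single K0] at hsum
    · have hprod : ∏ i, (Q a K0 i).coeff (J i) = (n : k) + 1 := by
        rw [Finset.prod_eq_single a]
        · rw [hQa, hJa, hn]; exact (epoly_coeff _ _).2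
        · intro i _ hi
          rw [hJ i hi, hQ1 a K0 i hi]
        · simp
      rw [hprod] at hsum
      have h3 : b.repr p K0 ≠ 0 := Finsupp.mem_support_iff.1 hmax.1
      have h4 : (n : k) + 1 ≠ 0 := Nat.cast_add_one_ne_zero n
      exact mul_ne_zero h3 h4 (by simpa using hsum.symm)
    · intro K hK hKne
      by_contra hne0
      have hpr := Finset.prod_ne_zero_iff.1 (right_ne_zero_of_mul hne0)
      apply hKne
      have hge : K0 ≤ K := by
        intro i
        have hi := hpr i (Finset.mem_univ i)
        by_contra hcon
        have hlt : K i < K0 i := not_le.1 hcon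
        apply hi
        by_cases hia : i = a
        · subst hia
          rw [hQa, hJa]
          exact (epoly_coeff _ _).1 _ (by omega)
        · rw [hJ i hia]
          exact hQ0 a K i _ hia (by omega)
      exact le_antisymm (hmax.2 hK hge) hge
    · intro h
      exact absurd hmax.1 h
  refine ⟨b.repr p 0, ?_⟩
  have hb0 : b 0 = 1 := by rw [hb]; simp
  rw [← hb0]
  apply b.repr.injective
  ext K
  rw [map_smul, b.repr_self, Finsupp.smul_apply, Finsupp.single_apply]
  split_ifs with h
  · subst h; simp
  · rw [smul_zero]
    by_contra h5
    exact h (hsupp K (Finsupp.mem_support_iff.2 h5)).symm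

end Helpers

/-- Assume `char k = 0` and that the ordered monomials form a
`k`-basis of `𝒟` (PBW basis).  If `∂_a(p) = 0` for every `a`, then `p` is a
scalar multiple of the identity. -/
theorem partial_eq_zero_imp_scalar (hL : 3 ≤ L) (hLN : L ≤ N) (hg : g ≠ 0)
    (hx : ∀ s : Fin N, L ≤ (s : ℕ) → x s = 0)
    (hgs : ∀ s : Fin N, L ≤ (s : ℕ) → gs s ≠ 0)
    [CharZero k]
    (hli : LinearIndependent k (fun K : Fin N → ℕ => monomial k N L g x gs K))
    (hspan : Submodule.span k
        (Set.range (fun K : Fin N → ℕ => monomial k N L g x gs K)) = ⊤)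
    (ν : Fin N → (Diff k N L g x gs →ₐ[k] Diff k N L g x gs))
    (pd : Fin N → (Diff k N L g x gs →ₗ[k] Diff k N L g x gs))
    (hν : ∀ a : Fin N, IsNu k N L g x gs a (ν a))
    (hpd : ∀ a : Fin N, IsPartial k N L g x gs a (ν a) (pd a))
    (p : Diff k N L g x gs) (hp : ∀ a : Fin N, pd a p = 0) :
    ∃ c : k, p = c • (1 : Diff k N L g x gs) := by
  let b := Module.Basis.mk hli hspan.ge
  have hb : ∀ K, b K = monomial k N L g x gs K := fun K => Module.Basis.mk_apply hli _ K
  refine abstract_main N (D k N L g x gs) b hb ν pd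
    (fun a i => if (i : ℕ) < L then (if (a : ℕ) < L then g⁻¹ * x i else (gs a)⁻¹ * x i) else 0)
    ?_ (fun a i => (hpd a).1 i) (fun a => (hpd a).2) p hp
  intro a i
  have h := hν a
  unfold IsNu at h
  split_ifs at h with ha
  · by_cases hi : (i : ℕ) < L
    · simp [h.1 i hi, hi, ha, Algebra.algebraMap_eq_smul_one]
    · simp [h.2 i (by omega), hi]
  · by_cases hi : (i : ℕ) < L
    · simp [h.1 i hi, hi, ha, Algebra.algebraMap_eq_smul_one]
    · simp [h.2 i (by omega), hi]

end DiffusionAI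
end
end

section
/- There exists a unique k-algebra homomorphism ν_{i0} : 𝒟 → 𝒟 satisfying ν_{i0}(D_{i0}) = D_{i0} and ν_{i0}(D_s) = 𝒢·(𝒢 − Λ)⁻¹·D_s for all s ∈ S. -/
/-!
The diffusion algebra of type `C` on `N` generators over a field `k`, with
`I = {i0}` and `S = {1,…,N} \ {i0}`, and common coefficient `G` (denoted `𝒢`
in the paper).  It is the quotient of the free associative unital `k`-algebra
on generators `D_1, …, D_N` by the two-sided ideal generated by the elements
`G·D_{i0}·D_s − (G − Λ)·D_s·D_{i0} + x·D_s` for `s ∈ S` and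
`D_s·D_l − D_l·D_s` for `s, l ∈ S`.
-/

noncomputable section

namespace DiffusionC

open FreeAlgebra

variable (k : Type*) [Field k] (N : ℕ) (i0 : Fin N) (Λ x G : k)

/-- The defining relations of the type `C` diffusion algebra. -/
def rel : FreeAlgebra k (Fin N) → FreeAlgebra k (Fin N) → Prop := fun a b =>
  (∃ s : Fin N, s ≠ i0 ∧
      a = G • (ι k i0 * ι k s) ∧
      b = (G - Λ) • (ι k s * ι k i0) - x • ι k s) ∨
  (∃ s l : Fin N, s ≠ i0 ∧ l ≠ i0 ∧
      a = ι k s * ι k l ∧ b = ι k l * ι k s)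

/-- The diffusion algebra `𝒟` of type `C`. -/
abbrev Diff := RingQuot (rel k N i0 Λ x G)

/-- The images of the generators `D_i` in `𝒟`. -/
def D (i : Fin N) : Diff k N i0 Λ x G :=
  RingQuot.mkAlgHom k (rel k N i0 Λ x G) (ι k i)

theorem D_rel_i0 (s : Fin N) (hs : s ≠ i0) :
    G • (D k N i0 Λ x G i0 * D k N i0 Λ x G s) =
      (G - Λ) • (D k N i0 Λ x G s * D k N i0 Λ x G i0) - x • D k N i0 Λ x G s := by
  have h : rel k N i0 Λ x G (G • (ι k i0 * ι k s))
      ((G - Λ) • (ι k s * ι k i0) - x • ι k s) := Or.inl ⟨s, hs, rfl, rfl⟩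
  have h2 := RingQuot.mkAlgHom_rel k h
  rw [map_sub, map_smul, map_smul, map_smul, map_mul, map_mul] at h2
  exact h2

theorem D_comm (s l : Fin N) (hs : s ≠ i0) (hl : l ≠ i0) :
    D k N i0 Λ x G s * D k N i0 Λ x G l = D k N i0 Λ x G l * D k N i0 Λ x G s := by
  have h : rel k N i0 Λ x G (ι k s * ι k l) (ι k l * ι k s) :=
    Or.inr ⟨s, l, hs, hl, rfl, rfl⟩
  have h2 := RingQuot.mkAlgHom_rel k h
  rw [map_mul, map_mul] at h2
  exact h2

/-- For every scalar `c` there is an endomorphism fixing `D_{i0}` and scaling the `D_s` by `c`. -/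
theorem exists_scale (c : k) :
    ∃ ν : Diff k N i0 Λ x G →ₐ[k] Diff k N i0 Λ x G,
      ν (D k N i0 Λ x G i0) = D k N i0 Λ x G i0 ∧
      ∀ s : Fin N, s ≠ i0 → ν (D k N i0 Λ x G s) = c • D k N i0 Λ x G s := by
  let f : FreeAlgebra k (Fin N) →ₐ[k] Diff k N i0 Λ x G :=
    FreeAlgebra.lift k (fun i => if i = i0 then D k N i0 Λ x G i0 else c • D k N i0 Λ x G i)
  have f0 : f (ι k i0) = D k N i0 Λ x G i0 := by simp [f]
  have fs : ∀ s, s ≠ i0 → f (ι k s) = c • D k N i0 Λ x G s := by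
    intro s hs
    simp [f, hs]
  have hf : ∀ ⦃a b⦄, rel k N i0 Λ x G a b → f a = f b := by
    rintro a b (⟨s, hs, rfl, rfl⟩ | ⟨s, l, hs, hl, rfl, rfl⟩)
    · rw [map_sub, map_smul, map_smul, map_smul, map_mul, map_mul, f0, fs s hs,
        mul_smul_comm, smul_mul_assoc, smul_comm G c, D_rel_i0 k N i0 Λ x G s hs, smul_sub,
        smul_comm c (G - Λ), smul_comm c x]
    · rw [map_mul, map_mul, fs s hs, fs l hl, smul_mul_smul_comm, smul_mul_smul_comm,
        D_comm k N i0 Λ x G s l hs hl]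
  refine ⟨RingQuot.liftAlgHom k ⟨f, hf⟩, ?_, ?_⟩
  · exact (RingQuot.liftAlgHom_mkAlgHom_apply k f hf _).trans f0
  · intro s hs
    exact (RingQuot.liftAlgHom_mkAlgHom_apply k f hf _).trans (fs s hs)

/-- There exists a unique `k`-algebra homomorphism
`ν_{i0} : 𝒟 → 𝒟` with `ν_{i0}(D_{i0}) = D_{i0}` and
`ν_{i0}(D_s) = 𝒢·(𝒢 − Λ)⁻¹·D_s` for all `s ∈ S`. -/
theorem existsUnique_nuI0 (hN : 3 ≤ N) (hG0 : G ≠ 0) (hGΛ : G ≠ Λ) :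
    ∃! ν : Diff k N i0 Λ x G →ₐ[k] Diff k N i0 Λ x G,
      ν (D k N i0 Λ x G i0) = D k N i0 Λ x G i0 ∧
      ∀ s : Fin N, s ≠ i0 →
        ν (D k N i0 Λ x G s) = (G * (G - Λ)⁻¹) • D k N i0 Λ x G s := by
  obtain ⟨ν, h0, hs⟩ := exists_scale k N i0 Λ x G (G * (G - Λ)⁻¹)
  refine ⟨ν, ⟨h0, hs⟩, ?_⟩
  rintro μ ⟨g0, gs⟩
  apply RingQuot.ringQuot_ext'
  apply FreeAlgebra.hom_ext
  funext i
  change μ (D k N i0 Λ x G i) = ν (D k N i0 Λ x G i)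
  by_cases hi : i = i0
  · rw [hi, g0, h0]
  · rw [gs i hi, hs i hi]

end DiffusionC
end
end

section
/- For every (k_1,…,k_N) ∈ ℕ^N the twisted partial derivatives of the ordered monomial D_1^{k_1}·D_2^{k_2}·…·D_N^{k_N} are given by: (1) ∂_{i0}(D_1^{k_1}·…·D_N^{k_N}) = 𝒢^{K}·(𝒢 − Λ)^{−K}·k_{i0}·D_1^{k_1}·…·D_{i0}^{k_{i0}−1}·…·D_N^{k_N}, where K = ∑_{j<i0} k_j; (2) for s ∈ S with s < i0, ∂_s(D_1^{k_1}·…·D_N^{k_N}) = k_s·D_1^{k_1}·…·D_s^{k_s−1}·…·D_N^{k_N}; (3) for s ∈ S with s > i0, ∂_s(D_1^{k_1}·…·D_N^{k_N}) = k_s·𝒢^{−k_{i0}}·D_1^{k_1}·…·((𝒢 − Λ)·D_{i0} − x)^{k_{i0}}·…·D_s^{k_s−1}·…·D_N^{k_N} (in each case the exponent of the indicated generator is reduced by one and the expression is 0 when that exponent is 0). -/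
/-!
The diffusion algebra of type `C` on `N` generators over a field `k`, with
`I = {i0}` and `S = {1,…,N} \ {i0}`, and common coefficient `G` (denoted `𝒢`
in the paper).  It is the quotient of the free associative unital `k`-algebra
on generators `D_1, …, D_N` by the two-sided ideal generated by the elements
`G·D_{i0}·D_s − (G − Λ)·D_s·D_{i0} + x·D_s` for `s ∈ S` and
`D_s·D_l − D_l·D_s` for `s, l ∈ S`.
-/

noncomputable section

namespace DiffusionC

open FreeAlgebra

variable (k : Type*) [Field k] (N : ℕ) (i0 : Fin N) (Λ x G : k)

/-- The defining property of the endomorphism `ν_{i0}` of `𝒟`: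
`ν_{i0}(D_{i0}) = D_{i0}` and `ν_{i0}(D_s) = 𝒢·(𝒢 − Λ)⁻¹·D_s` for `s ∈ S`. -/
def IsNuI0 (ν : Diff k N i0 Λ x G →ₐ[k] Diff k N i0 Λ x G) : Prop :=
  ν (D k N i0 Λ x G i0) = D k N i0 Λ x G i0 ∧
  ∀ s : Fin N, s ≠ i0 →
    ν (D k N i0 Λ x G s) = (G * (G - Λ)⁻¹) • D k N i0 Λ x G s

/-- The defining property of the endomorphism `ν_s` of `𝒟` (`s ∈ S`):
`ν_s(D_{i0}) = 𝒢⁻¹·((𝒢 − Λ)·D_{i0} − x)` and `ν_s(D_l) = D_l` for `l ∈ S`. -/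
def IsNuS (s : Fin N) (ν : Diff k N i0 Λ x G →ₐ[k] Diff k N i0 Λ x G) : Prop :=
  ν (D k N i0 Λ x G i0) = G⁻¹ • ((G - Λ) • D k N i0 Λ x G i0 - x • 1) ∧
  ∀ l : Fin N, l ≠ i0 → ν (D k N i0 Λ x G l) = D k N i0 Λ x G l

/-- `ν_a` is `ν_{i0}` for `a = i0` and `ν_a` for `a ∈ S`. -/
def IsNu (a : Fin N) (ν : Diff k N i0 Λ x G →ₐ[k] Diff k N i0 Λ x G) : Prop :=
  if a = i0 then IsNuI0 k N i0 Λ x G ν else IsNuS k N i0 Λ x G a ν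

/-- The defining property of the twisted partial derivative `∂_a : 𝒟 → 𝒟`
(relative to `ν = ν_a`): it is `k`-linear, `∂_a(D_b) = δ_{ab}·1`, and
`∂_a(p·q) = ∂_a(p)·q + ν_a(p)·∂_a(q)` for all `p, q ∈ 𝒟`. -/
def IsPartial (a : Fin N) (ν : Diff k N i0 Λ x G →ₐ[k] Diff k N i0 Λ x G)
    (pd : Diff k N i0 Λ x G →ₗ[k] Diff k N i0 Λ x G) : Prop :=
  (∀ b : Fin N, pd (D k N i0 Λ x G b) = if b = a then 1 else 0) ∧
  ∀ p q : Diff k N i0 Λ x G, pd (p * q) = pd p * q + ν p * pd q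

/-- The ordered monomial `D_0^{K_0}·D_1^{K_1}·⋯·D_{N-1}^{K_{N-1}}` in `𝒟`. -/
def monomial (K : Fin N → ℕ) : Diff k N i0 Λ x G :=
  ((List.finRange N).map (fun i => D k N i0 Λ x G i ^ K i)).prod

section helpers

theorem nu_list_prod {k A ι : Type*} [Field k] [Ring A] [Algebra k A]
    (ν : A →ₐ[k] A) (f g : ι → A) (c : ι → k) (l : List ι)
    (h : ∀ j ∈ l, ν (f j) = c j • g j) :
    ν (l.map f).prod = (l.map c).prod • (l.map g).prod := by
  induction l with
  | nil => simp
  | cons b t ih =>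
    have h1 := h b (by simp)
    have h2 := ih (fun j hj => h j (by simp [hj]))
    simp only [List.map_cons, List.prod_cons, map_mul, h1, h2, smul_mul_smul_comm]

theorem pd_one {k A : Type*} [Field k] [Ring A] [Algebra k A]
    (ν : A →ₐ[k] A) (pd : A →ₗ[k] A)
    (hp : ∀ p q, pd (p * q) = pd p * q + ν p * pd q) : pd 1 = 0 := by
  have := hp 1 1
  simpa using this

theorem pd_list_zero {k A ι : Type*} [Field k] [Ring A] [Algebra k A]
    (ν : A →ₐ[k] A) (pd : A →ₗ[k] A)
    (hp : ∀ p q, pd (p * q) = pd p * q + ν p * pd q) (f : ι → A) (l : List ι)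
    (h : ∀ j ∈ l, pd (f j) = 0) : pd (l.map f).prod = 0 := by
  induction l with
  | nil => simpa using pd_one ν pd hp
  | cons b t ih =>
    have h1 := h b (by simp)
    have h2 := ih (fun j hj => h j (by simp [hj]))
    simp [hp, h1, h2]

theorem pd_pow_zero {k A : Type*} [Field k] [Ring A] [Algebra k A]
    (ν : A →ₐ[k] A) (pd : A →ₗ[k] A)
    (hp : ∀ p q, pd (p * q) = pd p * q + ν p * pd q) (d : A) (h : pd d = 0) (n : ℕ) :
    pd (d ^ n) = 0 := by
  induction n with
  | zero => simpa using pd_one ν pd hp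
  | succ n ih => simp [pow_succ, hp, h, ih]

theorem pd_pow {k A : Type*} [Field k] [Ring A] [Algebra k A]
    (ν : A →ₐ[k] A) (pd : A →ₗ[k] A)
    (hp : ∀ p q, pd (p * q) = pd p * q + ν p * pd q) (d : A) (h : pd d = 1)
    (hd : ν d = d) (n : ℕ) :
    pd (d ^ n) = (n : k) • d ^ (n - 1) := by
  induction n with
  | zero => simpa using pd_one ν pd hp
  | succ n ih =>
    rw [pow_succ', hp, h, hd, ih]
    rcases n with _ | n
    · simp
    · simp only [Nat.add_sub_cancel, mul_smul_comm, ← pow_succ', one_mul]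
      push_cast
      simp only [add_smul, one_smul]
      abel

theorem finRange_split (N : ℕ) (a : Fin N) : ∃ l1 l2 : List (Fin N),
    List.finRange N = l1 ++ a :: l2 ∧ (∀ j, j ∈ l1 ↔ j < a) ∧ (∀ j, j ∈ l2 ↔ a < j) ∧
      l1.Nodup := by
  obtain ⟨l1, l2, h⟩ := List.append_of_mem (List.mem_finRange a)
  have hs : (List.finRange N).Pairwise (· < ·) := List.pairwise_lt_finRange N
  have hm : ∀ j, j ∈ l1 ++ a :: l2 := fun j => h ▸ List.mem_finRange j
  have hn := List.nodup_finRange N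
  rw [h] at hs hn
  rw [List.pairwise_append, List.pairwise_cons] at hs
  obtain ⟨_, ⟨h2, _⟩, h1⟩ := hs
  have h1' : ∀ j ∈ l1, j < a := fun j hj => h1 j hj a (by simp)
  refine ⟨l1, l2, h, fun j => ⟨h1' j, fun hj => ?_⟩, fun j => ⟨h2 j, fun hj => ?_⟩,
    hn.of_append_left⟩
  · have := hm j
    simp only [List.mem_append, List.mem_cons] at this
    rcases this with h | h | h
    · exact h
    · exact absurd h hj.ne
    · exact absurd (h2 j h) hj.asymm
  · have := hm j
    simp only [List.mem_append, List.mem_cons] at this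
    rcases this with h | h | h
    · exact absurd (h1' j h) hj.asymm
    · exact absurd h hj.ne'
    · exact h

/-- General formula: the derivative of an ordered product of powers. -/
theorem pd_ordered {k A : Type*} [Field k] [Ring A] [Algebra k A] {N : ℕ}
    (ν : A →ₐ[k] A) (pd : A →ₗ[k] A)
    (hp : ∀ p q, pd (p * q) = pd p * q + ν p * pd q) (d : Fin N → A) (a : Fin N)
    (hd : ∀ b, pd (d b) = if b = a then 1 else 0) (ha : ν (d a) = d a) (K : Fin N → ℕ)
    (c : Fin N → k) (g : Fin N → A)
    (h1 : ∀ j, j < a → ν (d j ^ K j) = c j • g j)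
    (h2 : g a = d a ^ (K a - 1))
    (h3 : ∀ j, a < j → g j = d j ^ K j) :
    pd ((List.finRange N).map (fun j => d j ^ K j)).prod =
      ((∏ j ∈ Finset.univ.filter (fun j : Fin N => j < a), c j) * (K a : k)) •
        ((List.finRange N).map g).prod := by
  obtain ⟨l1, l2, h, m1, m2, hn⟩ := finRange_split N a
  have z : ∀ j, j ≠ a → pd (d j ^ K j) = 0 := fun j hj =>
    pd_pow_zero ν pd hp _ (by simp [hd, hj]) _
  have z1 := pd_list_zero ν pd hp (fun j => d j ^ K j) l1
    (fun j hj => z j ((m1 j).1 hj).ne)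
  have z2 := pd_list_zero ν pd hp (fun j => d j ^ K j) l2
    (fun j hj => z j ((m2 j).1 hj).ne')
  have e2 : l2.map (fun j => d j ^ K j) = l2.map g :=
    List.map_congr_left (fun j hj => (h3 j ((m2 j).1 hj)).symm)
  have e1 := nu_list_prod ν (fun j => d j ^ K j) g c l1 (fun j hj => h1 j ((m1 j).1 hj))
  have ef : Finset.univ.filter (fun j : Fin N => j < a) = l1.toFinset := by
    ext j; simp [m1]
  rw [ef, List.prod_toFinset _ hn, h]
  simp only [List.map_append, List.map_cons, List.prod_append, List.prod_cons]
  rw [hp, z1, e1, hp, z2, pd_pow ν pd hp _ (by simp [hd]) ha, e2, h2]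
  simp only [zero_mul, zero_add, mul_zero, add_zero, smul_mul_smul_comm, smul_mul_assoc,
    mul_smul_comm, smul_smul]
  try rw [mul_comm]

end helpers

/-- The twisted partial derivatives of the ordered monomial
`D_1^{k_1}⋯D_N^{k_N}`:
(1) `∂_{i0}` multiplies by `𝒢^K·(𝒢 − Λ)^{−K}·k_{i0}` (where `K = ∑_{j<i0} k_j`)
and lowers the exponent of `D_{i0}` by one;
(2) for `s ∈ S` with `s < i0`, `∂_s` multiplies by `k_s` and lowers the
exponent of `D_s` by one;
(3) for `s ∈ S` with `s > i0`, `∂_s` multiplies by `k_s·𝒢^{−k_{i0}}`, replaces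
the factor `D_{i0}^{k_{i0}}` by `((𝒢 − Λ)·D_{i0} − x)^{k_{i0}}`, and lowers the
exponent of `D_s` by one. -/
theorem partial_monomial (hN : 3 ≤ N) (hG0 : G ≠ 0) (hGΛ : G ≠ Λ)
    (a : Fin N) (ν : Diff k N i0 Λ x G →ₐ[k] Diff k N i0 Λ x G)
    (hν : IsNu k N i0 Λ x G a ν)
    (pd : Diff k N i0 Λ x G →ₗ[k] Diff k N i0 Λ x G)
    (hpd : IsPartial k N i0 Λ x G a ν pd) (K : Fin N → ℕ) :
    (a = i0 →
      pd (monomial k N i0 Λ x G K) =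
        (G ^ (∑ j ∈ Finset.univ.filter (fun j : Fin N => j < i0), K j) *
          (G - Λ)⁻¹ ^ (∑ j ∈ Finset.univ.filter (fun j : Fin N => j < i0), K j) *
          (K i0 : k)) •
          monomial k N i0 Λ x G (Function.update K i0 (K i0 - 1))) ∧
    (a < i0 →
      pd (monomial k N i0 Λ x G K) =
        (K a : k) • monomial k N i0 Λ x G (Function.update K a (K a - 1))) ∧
    (i0 < a →
      pd (monomial k N i0 Λ x G K) =
        ((K a : k) * G⁻¹ ^ K i0) •
          ((List.finRange N).map (fun j =>
              if j = i0 then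
                ((G - Λ) • D k N i0 Λ x G i0 - x • 1) ^ K i0
              else
                D k N i0 Λ x G j ^ (if j = a then K a - 1 else K j))).prod) := by
  unfold IsNu at hν
  obtain ⟨hd, hp⟩ := hpd
  refine ⟨fun h => ?_, fun h => ?_, fun h => ?_⟩
  · subst h
    rw [if_pos rfl] at hν
    obtain ⟨hν0, hνs⟩ := hν
    have := pd_ordered ν pd hp (D k N a Λ x G) a hd hν0 K (fun j => (G * (G - Λ)⁻¹) ^ K j)
      (fun j => D k N a Λ x G j ^ (Function.update K a (K a - 1) j))
      (fun j hj => by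
        simp only [map_pow, hνs j hj.ne, smul_pow, Function.update_of_ne hj.ne])
      (by simp)
      (fun j hj => by simp only [Function.update_of_ne hj.ne'])
    rw [Finset.prod_pow_eq_pow_sum, mul_pow] at this
    exact this
  · rw [if_neg h.ne] at hν
    obtain ⟨hν0, hνs⟩ := hν
    have := pd_ordered ν pd hp (D k N i0 Λ x G) a hd (hνs a h.ne) K (fun j => 1)
      (fun j => D k N i0 Λ x G j ^ (Function.update K a (K a - 1) j))
      (fun j hj => by
        simp only [map_pow, hνs j (hj.trans h).ne, one_smul, Function.update_of_ne hj.ne])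
      (by simp)
      (fun j hj => by simp only [Function.update_of_ne hj.ne'])
    rw [Finset.prod_const_one, one_mul] at this
    exact this
  · rw [if_neg h.ne'] at hν
    obtain ⟨hν0, hνs⟩ := hν
    have := pd_ordered ν pd hp (D k N i0 Λ x G) a hd (hνs a h.ne') K
      (fun j => if j = i0 then G⁻¹ ^ K i0 else 1)
      (fun j => if j = i0 then ((G - Λ) • D k N i0 Λ x G i0 - x • 1) ^ K i0
              else D k N i0 Λ x G j ^ (if j = a then K a - 1 else K j))
      (fun j hj => by
        by_cases hji : j = i0
        · subst hji
          simp only [map_pow, hν0, if_true, smul_pow]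
        · simp only [map_pow, hνs j hji, if_neg hji, if_neg hj.ne, one_smul])
      (by simp [h.ne'])
      (fun j hj => by simp only [if_neg (h.trans hj).ne', if_neg hj.ne'])
    rw [Finset.prod_ite_eq' , if_pos (by simp [h]), mul_comm] at this
    exact this

end DiffusionC
end
end

section
/- Assume char k = 0 and assume the family of ordered monomials (D_1^{k_1}·D_2^{k_2}·…·D_N^{k_N})_{(k_1,…,k_N) ∈ ℕ^N} is a k-vector space basis of 𝒟 (PBW basis). If p ∈ 𝒟 satisfies ∂_a(p) = 0 for every a ∈ {1,…,N}, then p is a scalar multiple of the identity, i.e. p ∈ k·1. -/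
/-!
The diffusion algebra of type `C` on `N` generators over a field `k`, with
`I = {i0}` and `S = {1,…,N} \ {i0}`, and common coefficient `G` (denoted `𝒢`
in the paper).  It is the quotient of the free associative unital `k`-algebra
on generators `D_1, …, D_N` by the two-sided ideal generated by the elements
`G·D_{i0}·D_s − (G − Λ)·D_s·D_{i0} + x·D_s` for `s ∈ S` and
`D_s·D_l − D_l·D_s` for `s, l ∈ S`.
-/

noncomputable section

namespace DiffusionC

open FreeAlgebra

variable (k : Type*) [Field k] (N : ℕ) (i0 : Fin N) (Λ x G : k)

section helpers

variable {k N i0 Λ x G}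

theorem pd_one_s12 {a : Fin N} {ν : Diff k N i0 Λ x G →ₐ[k] Diff k N i0 Λ x G}
    {pd : Diff k N i0 Λ x G →ₗ[k] Diff k N i0 Λ x G}
    (h : IsPartial k N i0 Λ x G a ν pd) : pd 1 = 0 := by
  have := h.2 1 1
  simpa using this

theorem pd_pow_ne {a b : Fin N} {ν : Diff k N i0 Λ x G →ₐ[k] Diff k N i0 Λ x G}
    {pd : Diff k N i0 Λ x G →ₗ[k] Diff k N i0 Λ x G}
    (h : IsPartial k N i0 Λ x G a ν pd) (hb : b ≠ a) (n : ℕ) :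
    pd (D k N i0 Λ x G b ^ n) = 0 := by
  induction n with
  | zero => rw [pow_zero]; exact pd_one_s12 h
  | succ n ih => rw [pow_succ, h.2, ih, h.1, if_neg hb]; simp

theorem pd_pow_self {a : Fin N} {ν : Diff k N i0 Λ x G →ₐ[k] Diff k N i0 Λ x G}
    {pd : Diff k N i0 Λ x G →ₗ[k] Diff k N i0 Λ x G}
    (h : IsPartial k N i0 Λ x G a ν pd)
    (hν : ν (D k N i0 Λ x G a) = D k N i0 Λ x G a) (n : ℕ) :
    pd (D k N i0 Λ x G a ^ n) = (n : k) • D k N i0 Λ x G a ^ (n - 1) := by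
  induction n with
  | zero => rw [pow_zero, pd_one_s12 h]; simp
  | succ n ih =>
    rw [pow_succ, h.2, ih, h.1, if_pos rfl, map_pow, hν]
    rcases n with _ | n
    · simp
    · simp only [Nat.add_sub_cancel, smul_mul_assoc, ← pow_succ, mul_one]
      push_cast
      simp only [add_smul, one_smul]

theorem pd_list_notMem {a : Fin N} {ν : Diff k N i0 Λ x G →ₐ[k] Diff k N i0 Λ x G}
    {pd : Diff k N i0 Λ x G →ₗ[k] Diff k N i0 Λ x G}
    (h : IsPartial k N i0 Λ x G a ν pd) (K : Fin N → ℕ) (l : List (Fin N)) (hl : a ∉ l) :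
    pd ((l.map (fun i => D k N i0 Λ x G i ^ K i)).prod) = 0 := by
  induction l with
  | nil => simpa using pd_one_s12 h
  | cons b l ih =>
    simp only [List.mem_cons, not_or] at hl
    rw [List.map_cons, List.prod_cons, h.2, ih hl.2, pd_pow_ne h (Ne.symm hl.1)]
    simp

theorem pd_list_mem {a : Fin N} {ν : Diff k N i0 Λ x G →ₐ[k] Diff k N i0 Λ x G}
    {pd : Diff k N i0 Λ x G →ₗ[k] Diff k N i0 Λ x G}
    (h : IsPartial k N i0 Λ x G a ν pd) (K : Fin N → ℕ)
    (hν : ν (D k N i0 Λ x G a) = D k N i0 Λ x G a)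
    (hc : ∀ i, ∃ c : k, c ≠ 0 ∧
      ν (D k N i0 Λ x G i ^ K i) = c • D k N i0 Λ x G i ^ K i)
    (l : List (Fin N)) (hn : l.Nodup) (hl : a ∈ l) :
    ∃ d : k, d ≠ 0 ∧ pd ((l.map (fun i => D k N i0 Λ x G i ^ K i)).prod) =
      (d * (K a : k)) • (l.map (fun i => D k N i0 Λ x G i ^
        (Function.update K a (K a - 1)) i)).prod := by
  induction l with
  | nil => simp at hl
  | cons b l ih =>
    rw [List.nodup_cons] at hn
    rw [List.map_cons, List.prod_cons, h.2, List.map_cons, List.prod_cons]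
    by_cases hb : b = a
    · subst hb
      refine ⟨1, one_ne_zero, ?_⟩
      rw [pd_list_notMem h K l hn.1, pd_pow_self h hν]
      have : l.map (fun i => D k N i0 Λ x G i ^ (Function.update K b (K b - 1)) i) =
          l.map (fun i => D k N i0 Λ x G i ^ K i) := by
        apply List.map_congr_left
        intro i hi
        have : i ≠ b := fun e => hn.1 (e ▸ hi)
        rw [Function.update_of_ne this]
      rw [this]
      simp
    · have hl' : a ∈ l := by
        rcases List.mem_cons.1 hl with e | e
        · exact absurd e.symm hb
        · exact e
      obtain ⟨d, hd, e⟩ := ih hn.2 hl'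
      obtain ⟨c, hc0, hc⟩ := hc b
      refine ⟨c * d, mul_ne_zero hc0 hd, ?_⟩
      rw [e, pd_pow_ne h hb, hc, Function.update_of_ne hb, zero_mul, zero_add,
        smul_mul_smul_comm, mul_assoc]

theorem coeff_zero [CharZero k] (a : Fin N)
    (pd : Diff k N i0 Λ x G →ₗ[k] Diff k N i0 Λ x G)
    (hli : LinearIndependent k (fun K : Fin N → ℕ => monomial k N i0 Λ x G K))
    (f : (Fin N → ℕ) →₀ k)
    (hf : ∀ K ∈ f.support, ∃ d : k, d ≠ 0 ∧ pd (monomial k N i0 Λ x G K) =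
      (d * (K a : k)) • monomial k N i0 Λ x G (Function.update K a (K a - 1)))
    (h0 : pd (f.sum fun K c => c • monomial k N i0 Λ x G K) = 0) :
    ∀ K ∈ f.support, K a = 0 := by
  classical
  choose! d hd he using hf
  have h1 : Finsupp.linearCombination k (fun K : Fin N → ℕ => monomial k N i0 Λ x G K)
      (∑ K ∈ f.support, Finsupp.single (Function.update K a (K a - 1))
        (f K * (d K * (K a : k)))) = 0 := by
    rw [map_sum, ← h0, Finsupp.sum, map_sum]
    refine Finset.sum_congr rfl fun K hK => ?_
    rw [Finsupp.linearCombination_single, map_smul, he K hK, smul_smul]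
  have h2 := (linearIndependent_iff.1 hli) _ h1
  intro K0 hK0
  by_contra hne
  have h3 := DFunLike.congr_fun h2 (Function.update K0 a (K0 a - 1))
  rw [Finsupp.finsetSum_apply, Finset.sum_eq_single K0] at h3
  · simp only [Finsupp.single_eq_same, Finsupp.coe_zero, Pi.zero_apply] at h3
    have := Finsupp.mem_support_iff.1 hK0
    have := hd K0 hK0
    have : (K0 a : k) ≠ 0 := by exact_mod_cast hne
    simp_all
  · intro K hK hKne
    by_cases hKa : K a = 0
    · simp [hKa]
    · rw [Finsupp.single_apply, if_neg]
      intro e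
      apply hKne
      funext i
      have ei := congrFun e i
      by_cases hi : i = a
      · subst hi
        simp only [Function.update_self] at ei
        omega
      · simpa only [Function.update_of_ne hi] using ei
  · intro h; exact absurd hK0 h

end helpers

/-- Assume `char k = 0` and that the ordered monomials form
a `k`-basis of `𝒟` (PBW basis).  If `∂_a(p) = 0` for every `a`, then `p` is a
scalar multiple of the identity. -/
theorem partial_eq_zero_imp_scalar (hN : 3 ≤ N) (hG0 : G ≠ 0) (hGΛ : G ≠ Λ)
    [CharZero k]
    (hli : LinearIndependent k (fun K : Fin N → ℕ => monomial k N i0 Λ x G K))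
    (hspan : Submodule.span k
        (Set.range (fun K : Fin N → ℕ => monomial k N i0 Λ x G K)) = ⊤)
    (ν : Fin N → (Diff k N i0 Λ x G →ₐ[k] Diff k N i0 Λ x G))
    (pd : Fin N → (Diff k N i0 Λ x G →ₗ[k] Diff k N i0 Λ x G))
    (hν : ∀ a : Fin N, IsNu k N i0 Λ x G a (ν a))
    (hpd : ∀ a : Fin N, IsPartial k N i0 Λ x G a (ν a) (pd a))
    (p : Diff k N i0 Λ x G) (hp : ∀ a : Fin N, pd a p = 0) :
    ∃ c : k, p = c • (1 : Diff k N i0 Λ x G) := by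
  have hGL : G - Λ ≠ 0 := sub_ne_zero.2 hGΛ
  have hmem : p ∈ Submodule.span k
      (Set.range (fun K : Fin N → ℕ => monomial k N i0 Λ x G K)) := by
    rw [hspan]; trivial
  obtain ⟨f, rfl⟩ := Finsupp.mem_span_range_iff_exists_finsupp.1 hmem
  have hi0 : ∀ K ∈ f.support, K i0 = 0 := by
    refine coeff_zero i0 (pd i0) hli f (fun K _ => ?_) (hp i0)
    have hn := hν i0
    rw [IsNu, if_pos rfl] at hn
    refine pd_list_mem (hpd i0) K hn.1 (fun i => ?_) _ (List.nodup_finRange N)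
      (List.mem_finRange i0)
    by_cases hi : i = i0
    · subst hi
      exact ⟨1, one_ne_zero, by rw [map_pow, hn.1, one_smul]⟩
    · exact ⟨(G * (G - Λ)⁻¹) ^ K i,
        pow_ne_zero _ (mul_ne_zero hG0 (inv_ne_zero hGL)), by
          rw [map_pow, hn.2 i hi, smul_pow]⟩
  have hall : ∀ K ∈ f.support, K = 0 := by
    intro K hK
    funext a
    by_cases ha : a = i0
    · rw [ha]; exact hi0 K hK
    · refine coeff_zero a (pd a) hli f (fun K hK => ?_) (hp a) K hK
      have hn := hν a
      rw [IsNu, if_neg ha] at hn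
      refine pd_list_mem (hpd a) K (hn.2 a ha) (fun i => ⟨1, one_ne_zero, ?_⟩) _
        (List.nodup_finRange N) (List.mem_finRange a)
      by_cases hi : i = i0
      · rw [hi, hi0 K hK, pow_zero, map_one, one_smul]
      · rw [map_pow, hn.2 i hi, one_smul]
  refine ⟨f 0, ?_⟩
  have h1 : monomial k N i0 Λ x G 0 = 1 := by
    simp [monomial]
  rw [Finsupp.sum, Finset.sum_eq_single 0, h1]
  · intro K hK hne; exact absurd (hall K hK) hne
  · intro h; rw [Finsupp.notMem_support_iff.1 h, zero_smul]


end DiffusionC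
end
end

section
/- If i ≠ t are indices in {1,…,N} and 𝒢, x ∈ k satisfy 𝒢·D_i·D_t + x·D_t = 0 in A, then 𝒢·D_t = 0 in A. -/
/-- Let `A` be an associative unital `k`-algebra with
elements `D_1, …, D_N`, and for each `a` let `ν_a` be a `k`-algebra
endomorphism of `A` and `∂_a : A → A` a `k`-linear map satisfying the
`ν_a`-twisted Leibniz rule and `∂_a(D_b) = δ_{ab}·1`.  If `i ≠ t` and
`𝒢·D_i·D_t + x·D_t = 0` in `A`, then `𝒢·D_t = 0` in `A`. -/
theorem smul_eq_zero_of_rel (k : Type*) [Field k] (A : Type*) [Ring A]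
    [Algebra k A] (N : ℕ) (D : Fin N → A)
    (ν : Fin N → (A →ₐ[k] A)) (pd : Fin N → (A →ₗ[k] A))
    (hLeib : ∀ (a : Fin N) (p q : A),
      pd a (p * q) = pd a p * q + ν a p * pd a q)
    (hD : ∀ a b : Fin N, pd a (D b) = if a = b then 1 else 0)
    (i t : Fin N) (hit : i ≠ t) (G x : k)
    (hrel : G • (D i * D t) + x • D t = 0) :
    G • D t = 0 := by
  have h := congrArg (pd i) hrel
  simpa [hLeib, hD, hit] using h
end

section
/- Suppose there are indices i ≠ t in {1,…,N} and scalars 𝒢, x ∈ k with 𝒢 ≠ 0 such that 𝒢·D_i·D_t + x·D_t = 0 holds in A and D_t ≠ 0. Then there exists no family ((ν_a, ∂_a))_{a=1,…,N} in which each ν_a is a k-algebra endomorphism of A and each ∂_a : A → A is a k-linear map satisfying ∂_a(p·q) = ∂_a(p)·q + ν_a(p)·∂_a(q) for all p, q ∈ A and ∂_a(D_b) = δ_{ab}·1 for all a, b. -/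
/-- Let `A` be an associative unital `k`-algebra with
elements `D_1, …, D_N`.  Suppose `i ≠ t`, `𝒢 ≠ 0`, `𝒢·D_i·D_t + x·D_t = 0` in
`A`, and `D_t ≠ 0`.  Then there is no family `((ν_a, ∂_a))_a` in which each
`ν_a` is a `k`-algebra endomorphism of `A` and each `∂_a : A → A` is a
`k`-linear map satisfying the `ν_a`-twisted Leibniz rule
`∂_a(p·q) = ∂_a(p)·q + ν_a(p)·∂_a(q)` and `∂_a(D_b) = δ_{ab}·1`. -/
theorem no_twisted_partials (k : Type*) [Field k] (A : Type*) [Ring A]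
    [Algebra k A] (N : ℕ) (D : Fin N → A)
    (i t : Fin N) (hit : i ≠ t) (G x : k) (hG : G ≠ 0)
    (hrel : G • (D i * D t) + x • D t = 0) (ht : D t ≠ 0) :
    ¬ ∃ (ν : Fin N → (A →ₐ[k] A)) (pd : Fin N → (A →ₗ[k] A)),
        (∀ (a : Fin N) (p q : A),
          pd a (p * q) = pd a p * q + ν a p * pd a q) ∧
        (∀ a b : Fin N, pd a (D b) = if a = b then 1 else 0) := by
  rintro ⟨ν, pd, hL, hD⟩
  have h := congrArg (pd i) hrel
  have h2 : G • D t = 0 := by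
    simpa only [map_add, map_smul, hL, hD, if_true, if_neg hit, one_mul, mul_zero,
      add_zero, smul_zero, map_zero] using h
  exact ht ((smul_eq_zero.mp h2).resolve_left hG)
end

section
/- Suppose there are indices i ≠ t in {1,…,N} and scalars 𝒢, x ∈ k with 𝒢 ≠ 0 such that 𝒢·D_t·D_i + x·D_t = 0 holds in A and D_t ≠ 0. Then there exists no family ((ν_a, ∂_a))_{a=1,…,N} in which each ν_a is an injective k-algebra endomorphism of A and each ∂_a : A → A is a k-linear map satisfying ∂_a(p·q) = ∂_a(p)·q + ν_a(p)·∂_a(q) for all p, q ∈ A and ∂_a(D_b) = δ_{ab}·1 for all a, b. -/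
/-- Let `A` be an associative unital `k`-algebra with
elements `D_1, …, D_N`.  Suppose `i ≠ t`, `𝒢 ≠ 0`, `𝒢·D_t·D_i + x·D_t = 0` in
`A`, and `D_t ≠ 0`.  Then there is no family `((ν_a, ∂_a))_a` in which each
`ν_a` is an injective `k`-algebra endomorphism of `A` and each `∂_a : A → A`
is a `k`-linear map satisfying the `ν_a`-twisted Leibniz rule
`∂_a(p·q) = ∂_a(p)·q + ν_a(p)·∂_a(q)` and `∂_a(D_b) = δ_{ab}·1`. -/
theorem no_twisted_partials_injective (k : Type*) [Field k] (A : Type*)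
    [Ring A] [Algebra k A] (N : ℕ) (D : Fin N → A)
    (i t : Fin N) (hit : i ≠ t) (G x : k) (hG : G ≠ 0)
    (hrel : G • (D t * D i) + x • D t = 0) (ht : D t ≠ 0) :
    ¬ ∃ (ν : Fin N → (A →ₐ[k] A)) (pd : Fin N → (A →ₗ[k] A)),
        (∀ a : Fin N, Function.Injective (ν a)) ∧
        (∀ (a : Fin N) (p q : A),
          pd a (p * q) = pd a p * q + ν a p * pd a q) ∧
        (∀ a b : Fin N, pd a (D b) = if a = b then 1 else 0) := by
  rintro ⟨ν, pd, hinj, hleib, hD⟩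
  have h := congrArg (pd i) hrel
  rw [map_add, map_smul, map_smul, hleib, hD, hD, if_neg hit, if_pos rfl, map_zero,
    zero_mul, zero_add, mul_one, smul_zero, add_zero] at h
  have h0 : ν i (D t) = 0 := (smul_eq_zero_iff_right hG).mp h
  exact ht (hinj i (by rw [h0, map_zero]))
end
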